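/- Exactly 182596118 of the 2^28 two-colourings of the 28 edges of K(C_3) contain no monochromatic planar K_4, i.e., the number of functions from the set of unordered pairs of distinct vertices of {0,1}^3 to Bool under which no four distinct coplanar vertices have all six connecting edges the same colour is 182596118. -/

import Mathlib

/-- The vertex `v : Fin 3 → Bool` of the cube, regarded as a point of `ℝ³`. -/
def toPoint (v : Fin 3 → Bool) : Fin 3 → ℝ := fun i => if v i then 1 else 0

/-- The edges of `K(C_3)`: unordered pairs of distinct vertices of the cube. -/
def Edge : Type := {e : Sym2 (Fin 3 → Bool) // ¬ e.IsDiag}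

/-- The edge joining two distinct vertices. -/
def edgeMk (a b : Fin 3 → Bool) (h : a ≠ b) : Edge :=
  ⟨s(a, b), fun hd => h (Sym2.mk_isDiag_iff.mp hd)⟩

/-- A 2-colouring of the 28 edges of `K(C_3)` contains no monochromatic planar `K₄`. -/
def NoMonoPlanarK4 (c : Edge → Bool) : Prop :=
  ∀ a b d e : Fin 3 → Bool,
    (hab : a ≠ b) → (had : a ≠ d) → (hae : a ≠ e) →
    (hbd : b ≠ d) → (hbe : b ≠ e) → (hde : d ≠ e) →
    Coplanar ℝ ({toPoint a, toPoint b, toPoint d, toPoint e} : Set (Fin 3 → ℝ)) →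
    ¬ (c (edgeMk a b hab) = c (edgeMk a d had) ∧
       c (edgeMk a b hab) = c (edgeMk a e hae) ∧
       c (edgeMk a b hab) = c (edgeMk b d hbd) ∧
       c (edgeMk a b hab) = c (edgeMk b e hbe) ∧
       c (edgeMk a b hab) = c (edgeMk d e hde))

/-- Replace `a` by `b`. -/
def mergeInto {α : Type*} [DecidableEq α] (a b i : α) : α := if i = a then b else i

/-- The colouring `c` satisfies all equations in `E`, and for no `p ∈ P` is it constant on the
set consisting of `p.1` and the members of `p.2`. -/
def Admissible {α : Type*} (E : List (α × α)) (P : List (α × List α)) (c : α → Bool) : Prop :=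
  (∀ e ∈ E, c e.1 = c e.2) ∧ ∀ p ∈ P, ¬ ∀ x ∈ p.2, c x = c p.1

instance {α : Type*} (E : List (α × α)) (P : List (α × List α)) :
    DecidablePred (Admissible E P) := fun c => by unfold Admissible; infer_instance

/-- The number of admissible colourings of an `m`-element type, scaled by
`2 ^ (E.length + (P.map (·.2.length)).sum)`, by inclusion-exclusion. -/
def scaledCount {α : Type*} [DecidableEq α] (m : ℕ) :
    ℕ → List (α × α) → List (α × List α) → ℤ
  | 0, _, _ => 2 ^ m
  | _ + 1, [], [] => 2 ^ m
  | n + 1, [], p :: P =>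
      2 ^ p.2.length * scaledCount m n [] P - scaledCount m n (p.2.map fun x => (x, p.1)) P
  | n + 1, e :: E, P =>
      if e.1 = e.2 then 2 * scaledCount m n E P
      else scaledCount m n (E.map (Prod.map (mergeInto e.1 e.2) (mergeInto e.1 e.2)))
        (P.map (Prod.map (mergeInto e.1 e.2) (List.map (mergeInto e.1 e.2))))

theorem admissible_map {α β : Type*} (f : α → β) (E : List (α × α)) (P : List (α × List α))
    (c : β → Bool) :
    Admissible (E.map (Prod.map f f)) (P.map (Prod.map f (List.map f))) c ↔
      Admissible E P (c ∘ f) := by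
  simp only [Admissible, List.forall_mem_map, Prod.map_fst, Prod.map_snd, Function.comp_apply]

theorem card_admissible_nil (α : Type*) [DecidableEq α] [Fintype α] :
    (Finset.univ.filter (Admissible ([] : List (α × α)) [])).card = 2 ^ Fintype.card α := by
  rw [Finset.filter_true_of_mem (by simp [Admissible])]
  simp

/-- Imposing `c a = c b` halves the number of colourings counted after the merge. -/
theorem card_filter_comp_mergeInto {α : Type*} [DecidableEq α] [Fintype α] {a b : α} (h : a ≠ b)
    (Q : (α → Bool) → Prop) [DecidablePred Q] :
    (Finset.univ.filter fun c : α → Bool => Q (c ∘ mergeInto a b)).card =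
      2 * (Finset.univ.filter fun c : α → Bool => c a = c b ∧ Q c).card := by
  have comp_eq : ∀ c : α → Bool, c a = c b → c ∘ mergeInto a b = c := by
    intro c hc
    funext i
    by_cases hi : i = a <;> simp [mergeInto, hi, hc]
  have comp_update : ∀ (c : α → Bool) (t : Bool),
      Function.update c a t ∘ mergeInto a b = c ∘ mergeInto a b := by
    intro c t
    funext i
    by_cases hi : i = a <;> simp [mergeInto, hi, h.symm]
  have same : (Finset.univ.filter fun c : α → Bool => c a = c b ∧ Q (c ∘ mergeInto a b)) =
      Finset.univ.filter fun c : α → Bool => c a = c b ∧ Q c := by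
    ext c
    simp only [Finset.mem_filter, Finset.mem_univ, true_and]
    exact and_congr_right fun hc => by rw [comp_eq c hc]
  have flip : (Finset.univ.filter fun c : α → Bool => ¬ c a = c b ∧ Q (c ∘ mergeInto a b)).card =
      (Finset.univ.filter fun c : α → Bool => c a = c b ∧ Q (c ∘ mergeInto a b)).card := by
    refine Finset.card_bij' (fun c _ => Function.update c a (!c a))
      (fun c _ => Function.update c a (!c a)) ?_ ?_ ?_ ?_
    · intro c
      simp only [Finset.mem_filter, Finset.mem_univ, true_and, comp_update]
      rintro ⟨hc, hQ⟩
      refine ⟨?_, hQ⟩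
      cases ha : c a <;> cases hb : c b <;> simp_all [h.symm]
    · intro c
      simp only [Finset.mem_filter, Finset.mem_univ, true_and, comp_update]
      rintro ⟨hc, hQ⟩
      refine ⟨?_, hQ⟩
      cases ha : c a <;> cases hb : c b <;> simp_all [h.symm]
    · intro c _
      simp
    · intro c _
      simp
  rw [← Finset.card_filter_add_card_filter_not (fun c : α → Bool => c a = c b),
    Finset.filter_filter, Finset.filter_filter]
  simp only [and_comm (a := Q _)]
  rw [flip, same, two_mul]

theorem scaledCount_eq {α : Type*} [DecidableEq α] [Fintype α] (n : ℕ) (E : List (α × α))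
    (P : List (α × List α)) (h : E.length + (P.map fun p => p.2.length + 1).sum ≤ n) :
    scaledCount (Fintype.card α) n E P =
      2 ^ (E.length + (P.map fun p => p.2.length).sum) *
        ((Finset.univ.filter (Admissible E P)).card : ℤ) := by
  induction n generalizing E P with
  | zero =>
    cases E <;> cases P <;> simp_all [scaledCount, card_admissible_nil]
  | succ n ih =>
    rcases E with _ | ⟨e, E⟩
    · rcases P with _ | ⟨p, P⟩
      · simp [scaledCount, card_admissible_nil]
      · have split : (Finset.univ.filter (Admissible [] P)).card =
            (Finset.univ.filter (Admissible (p.2.map fun x => (x, p.1)) P)).card +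
              (Finset.univ.filter (Admissible [] (p :: P))).card := by
          rw [← Finset.card_filter_add_card_filter_not (fun c : α → Bool => ∀ x ∈ p.2, c x = c p.1),
            Finset.filter_filter, Finset.filter_filter]
          congr 2 <;> ext c <;> simp only [Finset.mem_filter, Finset.mem_univ, true_and, Admissible,
            List.forall_mem_map, List.forall_mem_cons, List.not_mem_nil, false_implies,
            implies_true] <;> tauto
        simp only [List.map_cons, List.sum_cons, List.length_nil] at h
        rw [scaledCount, ih _ _ (by simp only [List.length_nil]; omega),
          ih _ _ (by simp only [List.length_map]; omega), split]
        simp only [List.length_nil, List.length_map, List.map_cons, List.sum_cons, zero_add,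
          pow_add]
        push_cast
        ring
    · simp only [List.length_cons] at h
      rw [scaledCount]
      split_ifs with he
      · have drop : Admissible (e :: E) P = Admissible E P := by
          funext c
          simp [Admissible, he]
        rw [ih _ _ (by omega)]
        simp only [drop, List.length_cons]
        ring
      · have merge := card_filter_comp_mergeInto he (Admissible E P)
        have cons : (Finset.univ.filter fun c : α → Bool => c e.1 = c e.2 ∧ Admissible E P c) =
            Finset.univ.filter (Admissible (e :: E) P) := by
          ext c
          simp only [Finset.mem_filter, Finset.mem_univ, true_and]
          simp only [Admissible, List.forall_mem_cons, and_assoc]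
        rw [cons] at merge
        have filter_map : (Finset.univ.filter (Admissible
            (E.map (Prod.map (mergeInto e.1 e.2) (mergeInto e.1 e.2)))
            (P.map (Prod.map (mergeInto e.1 e.2) (List.map (mergeInto e.1 e.2)))))) =
            Finset.univ.filter fun c => Admissible E P (c ∘ mergeInto e.1 e.2) := by
          ext c
          simp only [Finset.mem_filter, admissible_map]
        rw [ih, filter_map, merge]
        rotate_left
        · simp only [List.length_map, List.map_map, Function.comp_def, Prod.map_snd]
          omega
        simp only [List.length_map, List.map_map, Function.comp_def,
          Prod.map_snd, List.length_cons]
        push_cast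
        ring

/-- The vertices of the cube, numbered in binary. -/
def vertex (i : Fin 8) : Fin 3 → Bool := fun j => (i : ℕ).testBit j

/-- The number of the edge joining two distinct vertices. -/
def edgeIndex (i j : Fin 8) : Fin 28 :=
  Fin.ofNat 28 (max (i : ℕ) j * (max (i : ℕ) j - 1) / 2 + min (i : ℕ) j)

/-- The vertex sets of the six faces and the six diagonal rectangles of the cube. -/
def planeQuads : List (Fin 8 × Fin 8 × Fin 8 × Fin 8) :=
  [(0, 1, 2, 3), (0, 1, 4, 5), (0, 1, 6, 7), (0, 2, 4, 6), (0, 2, 5, 7), (0, 3, 4, 7),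
    (1, 2, 5, 6), (1, 3, 4, 6), (1, 3, 5, 7), (2, 3, 4, 5), (2, 3, 6, 7), (4, 5, 6, 7)]

/-- The six edges on four vertices, the first one singled out. -/
def quadEdges (q : Fin 8 × Fin 8 × Fin 8 × Fin 8) : Fin 28 × List (Fin 28) :=
  (edgeIndex q.1 q.2.1, [edgeIndex q.1 q.2.2.1, edgeIndex q.1 q.2.2.2,
    edgeIndex q.2.1 q.2.2.1, edgeIndex q.2.1 q.2.2.2, edgeIndex q.2.2.1 q.2.2.2])

theorem scaledCount_planeQuads :
    scaledCount 28 72 [] (planeQuads.map quadEdges) = 2 ^ 60 * 182596118 := by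
  decide +kernel

theorem card_admissible_planeQuads :
    (Finset.univ.filter (Admissible [] (planeQuads.map quadEdges))).card = 182596118 := by
  have h := scaledCount_eq 72 [] (planeQuads.map quadEdges) (by decide)
  rw [Fintype.card_fin, scaledCount_planeQuads] at h
  have hw : ([] : List (Fin 28 × Fin 28)).length +
      ((planeQuads.map quadEdges).map fun p => p.2.length).sum = 60 := by decide
  rw [hw] at h
  exact_mod_cast (mul_left_cancel₀ (by positivity) h).symm

theorem vertex_bijective : Function.Bijective vertex :=
  (Fintype.bijective_iff_injective_and_card vertex).2 ⟨by decide +kernel, by simp⟩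

theorem edgeIndex_comm (i j : Fin 8) : edgeIndex i j = edgeIndex j i := by
  simp only [edgeIndex, max_comm, min_comm]

theorem eq_or_eq_swap_of_edgeIndex_eq : ∀ i j k l : Fin 8, i ≠ j → k ≠ l →
    edgeIndex i j = edgeIndex k l → i = k ∧ j = l ∨ i = l ∧ j = k := by
  decide +kernel

/-- The numbering of the vertices of the cube. -/
noncomputable def vertexEquiv : Fin 8 ≃ (Fin 3 → Bool) := Equiv.ofBijective vertex vertex_bijective

/-- The numbering of the edges of `K(C_3)`. -/
noncomputable def edgeNumber (e : Edge) : Fin 28 :=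
  Sym2.lift ⟨fun a b => edgeIndex (vertexEquiv.symm a) (vertexEquiv.symm b),
    fun _ _ => edgeIndex_comm _ _⟩ e.1

theorem edgeNumber_bijective : Function.Bijective edgeNumber := by
  have : Fintype Edge := inferInstanceAs (Fintype {e : Sym2 (Fin 3 → Bool) // ¬ e.IsDiag})
  refine (Fintype.bijective_iff_injective_and_card edgeNumber).2 ⟨?_, ?_⟩
  · rintro ⟨e, he⟩ ⟨f, hf⟩ h
    induction e with | _ a b
    induction f with | _ x y
    rw [Sym2.mk_isDiag_iff] at he hf
    apply Subtype.ext
    have := eq_or_eq_swap_of_edgeIndex_eq _ _ _ _ (vertexEquiv.symm.injective.ne he)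
      (vertexEquiv.symm.injective.ne hf) h
    simpa using this
  · rw [Fintype.card_congr' (show Edge = {e : Sym2 (Fin 3 → Bool) // ¬ e.IsDiag} from rfl),
      Sym2.card_subtype_not_diag]
    simp [Nat.choose]

theorem edgeNumber_edgeMk (i j : Fin 8) (h : vertex i ≠ vertex j) :
    edgeNumber (edgeMk (vertex i) (vertex j) h) = edgeIndex i j := by
  have hv : ∀ k, vertexEquiv.symm (vertex k) = k := vertexEquiv.symm_apply_apply
  change edgeIndex (vertexEquiv.symm (vertex i)) (vertexEquiv.symm (vertex j)) = _
  rw [hv, hv]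

theorem coplanar_iff_det_eq_zero (a b c d : Fin 3 → ℝ) :
    Coplanar ℝ {a, b, c, d} ↔ (Matrix.of ![b - a, c - a, d - a]).det = 0 := by
  have hrange : ({a, b, c, d} : Set (Fin 3 → ℝ)) = Set.range ![a, b, c, d] := by
    simp only [Matrix.range_cons, Matrix.range_empty, Set.union_empty, Set.singleton_union]
  have hrows : (fun i : Fin 3 => ![a, b, c, d] (finSuccAboveEquiv 0 i) -ᵥ ![a, b, c, d] 0) =
      ![b - a, c - a, d - a] := by
    funext i
    fin_cases i <;> rfl
  rw [coplanar_iff_finrank_le_two, hrange,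
    finrank_vectorSpan_le_iff_not_affineIndependent ℝ _ (by simp),
    affineIndependent_iff_linearIndependent_vsub ℝ _ 0,
    ← linearIndependent_equiv (finSuccAboveEquiv (0 : Fin 4)), not_iff_comm]
  change ¬ _ ↔ LinearIndependent ℝ
    (fun i : Fin 3 => ![a, b, c, d] (finSuccAboveEquiv 0 i) -ᵥ ![a, b, c, d] 0)
  rw [hrows, ← ne_eq, ← isUnit_iff_ne_zero, ← Matrix.isUnit_iff_isUnit_det]
  exact Matrix.linearIndependent_rows_iff_isUnit.symm

/-- The coordinates of a vertex, as integers. -/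
def coord (i : Fin 8) (k : Fin 3) : ℤ := if vertex i k then 1 else 0

/-- The signed volume of the parallelepiped spanned at `q.1` by the other vertices of `q`. -/
def quadDet (q : Fin 8 × Fin 8 × Fin 8 × Fin 8) : ℤ :=
  let u := fun k => coord q.2.1 k - coord q.1 k
  let v := fun k => coord q.2.2.1 k - coord q.1 k
  let w := fun k => coord q.2.2.2 k - coord q.1 k
  u 0 * v 1 * w 2 - u 0 * v 2 * w 1 - u 1 * v 0 * w 2 + u 1 * v 2 * w 0 + u 2 * v 0 * w 1 -
    u 2 * v 1 * w 0

theorem coplanar_vertex_iff (i j k l : Fin 8) :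
    Coplanar ℝ {toPoint (vertex i), toPoint (vertex j), toPoint (vertex k), toPoint (vertex l)} ↔
      quadDet (i, j, k, l) = 0 := by
  have hcoord : ∀ i k, toPoint (vertex i) k = (coord i k : ℝ) := by
    intro i k
    simp [toPoint, coord]
  rw [coplanar_iff_det_eq_zero, Matrix.det_fin_three, ← Int.cast_eq_zero (α := ℝ)]
  simp [quadDet, hcoord]

/-- The list of the edges on four vertices. -/
def quadEdgeList (q : Fin 8 × Fin 8 × Fin 8 × Fin 8) : List (Fin 28) :=
  (quadEdges q).1 :: (quadEdges q).2

theorem exists_planeQuad : ∀ i j k l : Fin 8, i ≠ j → i ≠ k → i ≠ l → j ≠ k → j ≠ l → k ≠ l →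
    quadDet (i, j, k, l) = 0 →
      ∃ q ∈ planeQuads, ∀ e ∈ quadEdgeList q, e ∈ quadEdgeList (i, j, k, l) := by
  have h : ∀ i j k l : Fin 8, i ≠ j → i ≠ k → i ≠ l → j ≠ k → j ≠ l → k ≠ l →
      quadDet (i, j, k, l) = 0 → planeQuads.any fun q =>
        (quadEdgeList q).all fun e => (quadEdgeList (i, j, k, l)).contains e := by
    decide +kernel
  simpa only [List.any_eq_true, List.all_eq_true, List.contains_iff_mem] using h

theorem planeQuads_spec : ∀ q ∈ planeQuads, q.1 ≠ q.2.1 ∧ q.1 ≠ q.2.2.1 ∧ q.1 ≠ q.2.2.2 ∧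
    q.2.1 ≠ q.2.2.1 ∧ q.2.1 ≠ q.2.2.2 ∧ q.2.2.1 ≠ q.2.2.2 ∧ quadDet q = 0 := by
  have h : planeQuads.all fun q => q.1 ≠ q.2.1 ∧ q.1 ≠ q.2.2.1 ∧ q.1 ≠ q.2.2.2 ∧
      q.2.1 ≠ q.2.2.1 ∧ q.2.1 ≠ q.2.2.2 ∧ q.2.2.1 ≠ q.2.2.2 ∧ quadDet q = 0 := by
    decide +kernel
  simpa only [List.all_eq_true, decide_eq_true_eq] using h

theorem forall_quadEdges_iff (c : Fin 28 → Bool) (q : Fin 8 × Fin 8 × Fin 8 × Fin 8) :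
    (∀ x ∈ (quadEdges q).2, c x = c (quadEdges q).1) ↔
      ∃ t, ∀ x ∈ quadEdgeList q, c x = t := by
  simp [quadEdgeList]

theorem noMonoPlanarK4_comp_edgeNumber_iff (c : Fin 28 → Bool) :
    NoMonoPlanarK4 (c ∘ edgeNumber) ↔ Admissible [] (planeQuads.map quadEdges) c := by
  have hinj := vertex_bijective.injective
  simp only [NoMonoPlanarK4, vertex_bijective.surjective.forall, Function.comp_apply,
    edgeNumber_edgeMk, coplanar_vertex_iff]
  have key : ∀ i j k l : Fin 8,
      (c (edgeIndex i j) = c (edgeIndex i k) ∧ c (edgeIndex i j) = c (edgeIndex i l) ∧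
        c (edgeIndex i j) = c (edgeIndex j k) ∧ c (edgeIndex i j) = c (edgeIndex j l) ∧
        c (edgeIndex i j) = c (edgeIndex k l)) ↔
      ∃ t, ∀ x ∈ quadEdgeList (i, j, k, l), c x = t := by
    intro i j k l
    rw [← forall_quadEdges_iff]
    simp [quadEdges, eq_comm]
  simp only [key, Admissible, List.forall_mem_map, forall_quadEdges_iff]
  constructor
  · refine fun h => ⟨by simp, fun q hq => ?_⟩
    obtain ⟨h₁, h₂, h₃, h₄, h₅, h₆, hdet⟩ := planeQuads_spec q hq
    exact h q.1 q.2.1 q.2.2.1 q.2.2.2 (hinj.ne h₁) (hinj.ne h₂) (hinj.ne h₃) (hinj.ne h₄)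
      (hinj.ne h₅) (hinj.ne h₆) hdet
  · rintro ⟨-, h⟩ i j k l h₁ h₂ h₃ h₄ h₅ h₆ hdet ⟨t, ht⟩
    obtain ⟨q, hq, hsub⟩ := exists_planeQuad i j k l (ne_of_apply_ne _ h₁) (ne_of_apply_ne _ h₂)
      (ne_of_apply_ne _ h₃) (ne_of_apply_ne _ h₄) (ne_of_apply_ne _ h₅) (ne_of_apply_ne _ h₆) hdet
    exact h q hq ⟨t, fun x hx => ht x (hsub x hx)⟩

theorem count_good_colourings_C3 :
    Nat.card {c : Edge → Bool // NoMonoPlanarK4 c} = 182596118 := by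
  rw [← card_admissible_planeQuads, ← Fintype.card_subtype, ← Nat.card_eq_fintype_card]
  refine (Nat.card_congr (Equiv.subtypeEquiv
    ((Equiv.ofBijective edgeNumber edgeNumber_bijective).symm.arrowCongr (Equiv.refl Bool))
    fun c => ?_)).symm
  exact (noMonoPlanarK4_comp_edgeNumber_iff c).symm
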